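/- For the theta graph B_3(1,1,0) (two vertices joined by three internally disjoint paths of lengths 2, 2, and 1, i.e., K_4 minus an edge), PS(B_3(1,1,0)) = 14; and for the graph B_3'(1,1,0,n−4) obtained by attaching a pendant path P_{n−4} to a degree-2 vertex of B_3(1,1,0), PS(B_3'(1,1,0,n−4)) = 14·F(n−3) + 6·F(n−4) for n ≥ 5. -/

import Mathlib

open SimpleGraph Finset
open scoped Classical

noncomputable section

namespace PermSum

variable {V W : Type*}

/-- Number of cycle components of the spanning subgraph with edge set `M`:
components all of whose vertices have degree `2`. -/
noncomputable def numCycles [Fintype V] (M : Finset (Sym2 V)) : ℕ :=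
  Nat.card {c : (fromEdgeSet (↑M : Set (Sym2 V))).ConnectedComponent //
    ∀ v, (fromEdgeSet (↑M : Set (Sym2 V))).connectedComponentMk v = c →
      (fromEdgeSet (↑M : Set (Sym2 V))).degree v = 2}

/-- `M` is the edge set of a Sachs subgraph of `G`: each component of the graph it spans is a
single edge or a cycle (every covered vertex has degree 1 or 2, and any vertex of degree 1 has
its neighbours of degree 1). -/
def IsSachs [Fintype V] (G : SimpleGraph V) (M : Finset (Sym2 V)) : Prop :=
  (↑M : Set (Sym2 V)) ⊆ G.edgeSet ∧
  (∀ v ∈ (fromEdgeSet (↑M : Set (Sym2 V))).support,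
      (fromEdgeSet (↑M : Set (Sym2 V))).degree v = 1 ∨
      (fromEdgeSet (↑M : Set (Sym2 V))).degree v = 2) ∧
  (∀ v w, (fromEdgeSet (↑M : Set (Sym2 V))).Adj v w →
      (fromEdgeSet (↑M : Set (Sym2 V))).degree v = 1 →
      (fromEdgeSet (↑M : Set (Sym2 V))).degree w = 1)

/-- The permanental sum of a finite simple graph: `∑_H 2^{c(H)}` over all Sachs subgraphs `H`
(including the empty one). -/
noncomputable def PS [Fintype V] (G : SimpleGraph V) : ℕ :=
  ∑ M ∈ Finset.univ.filter (fun M : Finset (Sym2 V) => IsSachs G M), 2 ^ numCycles M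


/-- `B₃(1,1,0)` with a pendant path on `m` further vertices attached to a degree-2 vertex:
the path `0-1-⋯-(m+3)` together with the chords `{0,2}` and `{1,3}`; the vertices
`0,1,2,3` induce `K₄` minus the edge `{0,3}`, and the path is attached at `3`, a vertex of
degree `2` of the theta graph. -/
def B3deg2 (m : ℕ) : SimpleGraph (Fin (m + 4)) :=
  pathGraph (m + 4) ⊔
    fromEdgeSet {s((0 : Fin (m + 4)), (2 : Fin (m + 4))),
                 s((1 : Fin (m + 4)), (3 : Fin (m + 4)))}

/-- `B₃(1,1,0)` with a pendant path on `m` further vertices attached to a degree-3 vertex: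
the path `0-1-⋯-(m+3)` together with the chords `{0,3}` and `{1,3}`; the vertices
`0,1,2,3` induce `K₄` minus the edge `{0,2}`, and the path is attached at `3`, a vertex of
degree `3` of the theta graph. -/
def B3deg3 (m : ℕ) : SimpleGraph (Fin (m + 4)) :=
  pathGraph (m + 4) ⊔
    fromEdgeSet {s((0 : Fin (m + 4)), (3 : Fin (m + 4))),
                 s((1 : Fin (m + 4)), (3 : Fin (m + 4)))}

section Sachs

variable [Fintype V] [DecidableEq V] [Fintype W] [DecidableEq W]

/-- The neighbours of `x` in the graph with edge set `M`. -/
def nbrs (M : Finset (Sym2 V)) (x : V) : Finset V :=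
  Finset.univ.filter fun y => s(x, y) ∈ M ∧ x ≠ y

/-- The degree conditions of `IsSachs`, in decidable form. -/
def SachsDegrees (M : Finset (Sym2 V)) : Prop :=
  (∀ x, #(nbrs M x) ≤ 2) ∧ ∀ x, ∀ y ∈ nbrs M x, #(nbrs M x) = 1 → #(nbrs M y) = 1

instance (M : Finset (Sym2 V)) : Decidable (SachsDegrees M) := by
  unfold SachsDegrees; infer_instance

lemma mem_nbrs {M : Finset (Sym2 V)} {x y : V} : y ∈ nbrs M x ↔ s(x, y) ∈ M ∧ x ≠ y := by
  simp [nbrs]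

lemma mem_nbrs_comm {M : Finset (Sym2 V)} {x y : V} : y ∈ nbrs M x ↔ x ∈ nbrs M y := by
  rw [mem_nbrs, mem_nbrs, Sym2.eq_swap, ne_comm]

lemma fromEdgeSet_adj_iff {M : Finset (Sym2 V)} {x y : V} :
    (fromEdgeSet (↑M : Set (Sym2 V))).Adj x y ↔ y ∈ nbrs M x := by
  simp [mem_nbrs]

lemma degree_eq_card_nbrs (M : Finset (Sym2 V)) (x : V)
    [Fintype ((fromEdgeSet (↑M : Set (Sym2 V))).neighborSet x)] :
    (fromEdgeSet (↑M : Set (Sym2 V))).degree x = #(nbrs M x) := by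
  rw [← card_neighborFinset_eq_degree]
  congr 1
  ext y
  rw [mem_neighborFinset, fromEdgeSet_adj_iff]

lemma isSachs_iff {G : SimpleGraph V} {M : Finset (Sym2 V)} :
    IsSachs G M ↔ (↑M : Set (Sym2 V)) ⊆ G.edgeSet ∧ SachsDegrees M := by
  simp only [IsSachs, SachsDegrees, degree_eq_card_nbrs, fromEdgeSet_adj_iff, mem_support]
  refine and_congr_right fun _ => and_congr ⟨fun h x => ?_, ?_⟩ Iff.rfl
  · by_cases hx : ∃ y, y ∈ nbrs M x
    · rcases h x hx with h | h <;> omega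
    · push Not at hx
      simp [Finset.eq_empty_of_forall_notMem hx]
  · rintro h x ⟨y, hy⟩
    have := h x
    have := Finset.card_pos.2 ⟨y, hy⟩
    omega

lemma SachsDegrees.card_nbrs_eq_two {M : Finset (Sym2 V)} (h : SachsDegrees M) {x y : V}
    (hx : #(nbrs M x) = 2) (hy : y ∈ nbrs M x) : #(nbrs M y) = 2 := by
  have hy' := mem_nbrs_comm.1 hy
  have := h.1 y
  have := h.2 y x hy'
  have := Finset.card_pos.2 ⟨x, hy'⟩
  omega

/-- The subgraph induced by the vertices of degree two. -/
def cycleGraphPart (M : Finset (Sym2 V)) : SimpleGraph {x : V | #(nbrs M x) = 2} :=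
  (fromEdgeSet (↑M : Set (Sym2 V))).induce {x : V | #(nbrs M x) = 2}

lemma cycleGraphPart_adj {M : Finset (Sym2 V)} {x y : {x : V | #(nbrs M x) = 2}} :
    (cycleGraphPart M).Adj x y ↔ y.1 ∈ nbrs M x.1 := by
  simp only [cycleGraphPart, comap_adj, fromEdgeSet_adj_iff, Function.Embedding.subtype_apply]

lemma SachsDegrees.exists_reachable {M : Finset (Sym2 V)} (h : SachsDegrees M) {x y : V}
    (hx : #(nbrs M x) = 2) (hxy : (fromEdgeSet (↑M : Set (Sym2 V))).Reachable x y) :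
    ∃ hy : #(nbrs M y) = 2, (cycleGraphPart M).Reachable ⟨x, hx⟩ ⟨y, hy⟩ := by
  obtain ⟨p⟩ := hxy
  induction p with
  | nil => exact ⟨hx, .rfl⟩
  | cons hadj _ ih =>
    have hmem := fromEdgeSet_adj_iff.1 hadj
    have hv := h.card_nbrs_eq_two hx hmem
    obtain ⟨hy, hr⟩ := ih hv
    refine ⟨hy, Reachable.trans (Adj.reachable ?_) hr⟩
    exact cycleGraphPart_adj.2 hmem

lemma SachsDegrees.numCycles_eq {M : Finset (Sym2 V)} (h : SachsDegrees M) :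
    numCycles M = Nat.card (cycleGraphPart M).ConnectedComponent := by
  simp only [numCycles, degree_eq_card_nbrs]
  let φ : cycleGraphPart M →g fromEdgeSet (↑M : Set (Sym2 V)) := ⟨Subtype.val, fun h => h⟩
  have hφ : ∀ c : (cycleGraphPart M).ConnectedComponent, ∀ y,
      (fromEdgeSet (↑M : Set (Sym2 V))).connectedComponentMk y = c.map φ →
        #(nbrs M y) = 2 := by
    intro c y hy
    induction c using ConnectedComponent.ind with
    | h a => exact (h.exists_reachable a.2 (ConnectedComponent.exact hy).symm).1
  symm
  refine Nat.card_eq_of_bijective (fun c => ⟨c.map φ, hφ c⟩) ⟨?_, ?_⟩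
  · intro c d hcd
    induction c using ConnectedComponent.ind with
    | h a =>
      induction d using ConnectedComponent.ind with
      | h b =>
        have := ConnectedComponent.exact (Subtype.ext_iff.1 hcd)
        exact ConnectedComponent.sound (h.exists_reachable a.2 this).2
  · rintro ⟨c, hc⟩
    induction c using ConnectedComponent.ind with
    | h a => exact ⟨(cycleGraphPart M).connectedComponentMk ⟨a, hc a rfl⟩, rfl⟩

lemma numCycles_eq_of_equiv {M : Finset (Sym2 V)} {N : Finset (Sym2 W)} (hM : SachsDegrees M)
    (hN : SachsDegrees N) (f : V ↪ W)
    (hf : ∀ x, #(nbrs M x) = 2 → nbrs N (f x) = (nbrs M x).map f)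
    (hsurj : ∀ y, #(nbrs N y) = 2 → ∃ x, #(nbrs M x) = 2 ∧ f x = y) :
    numCycles M = numCycles N := by
  rw [hM.numCycles_eq, hN.numCycles_eq]
  let g : {x : V | #(nbrs M x) = 2} → {x : W | #(nbrs N x) = 2} :=
    fun x => ⟨f x.1, by
      rw [Set.mem_ofPred_eq, hf x.1 x.2, Finset.card_map]
      exact x.2⟩
  have hg : Function.Bijective g := by
    constructor
    · intro a b hab
      exact Subtype.ext (f.injective (Subtype.ext_iff.1 hab))
    · rintro ⟨y, hy⟩
      obtain ⟨x, hx, rfl⟩ := hsurj y hy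
      exact ⟨⟨x, hx⟩, rfl⟩
  let e : cycleGraphPart M ≃g cycleGraphPart N :=
    { toEquiv := Equiv.ofBijective g hg
      map_rel_iff' := by
        intro a b
        rw [cycleGraphPart_adj, cycleGraphPart_adj]
        change f b.1 ∈ nbrs N (f a.1) ↔ _
        rw [hf _ a.2]
        simp }
  exact Nat.card_congr e.connectedComponentEquiv

lemma nbrs_map (f : V ↪ W) (M : Finset (Sym2 V)) (x : V) :
    nbrs (M.map f.sym2Map) (f x) = (nbrs M x).map f := by
  ext y
  simp only [mem_nbrs, Finset.mem_map, Function.Embedding.sym2Map_apply]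
  constructor
  · rintro ⟨⟨e, he, hey⟩, hne⟩
    induction e using Sym2.ind with
    | h a b =>
      rw [Sym2.map_mk, Sym2.eq_iff] at hey
      rcases hey with ⟨h1, rfl⟩ | ⟨rfl, h1⟩
      · obtain rfl := f.injective h1
        exact ⟨b, ⟨he, fun h => hne (by rw [h])⟩, rfl⟩
      · obtain rfl := f.injective h1
        exact ⟨a, ⟨Sym2.eq_swap ▸ he, fun h => hne (by rw [h])⟩, rfl⟩
  · rintro ⟨z, ⟨hz, hne⟩, rfl⟩
    exact ⟨⟨_, hz, rfl⟩, fun h => hne (f.injective h)⟩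

lemma nbrs_map_of_notMem_range {U : Type*} (f : U ↪ W) (M : Finset (Sym2 U)) {y : W}
    (hy : y ∉ Set.range f) : nbrs (M.map f.sym2Map) y = ∅ := by
  refine Finset.eq_empty_of_forall_notMem fun z hz => hy ?_
  obtain ⟨e, -, he⟩ := Finset.mem_map.1 (mem_nbrs.1 hz).1
  induction e using Sym2.ind with
  | h a b =>
    rw [Function.Embedding.sym2Map_apply, Sym2.map_mk, Sym2.eq_iff] at he
    rcases he with ⟨h, -⟩ | ⟨-, h⟩ <;> exact ⟨_, h⟩

lemma sachsDegrees_map (f : V ↪ W) {M : Finset (Sym2 V)} :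
    SachsDegrees (M.map f.sym2Map) ↔ SachsDegrees M := by
  constructor
  · rintro ⟨h1, h2⟩
    refine ⟨fun x => by simpa [nbrs_map] using h1 (f x), fun x y hy => ?_⟩
    simpa [nbrs_map] using h2 (f x) (f y) (by simpa [nbrs_map] using hy)
  · rintro ⟨h1, h2⟩
    constructor
    · intro x
      by_cases hx : x ∈ Set.range f
      · obtain ⟨x, rfl⟩ := hx
        simpa [nbrs_map] using h1 x
      · simp [nbrs_map_of_notMem_range f M hx]
    · intro x y hy
      by_cases hx : x ∈ Set.range f
      · obtain ⟨x, rfl⟩ := hx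
        rw [nbrs_map] at hy
        obtain ⟨z, hz, rfl⟩ := Finset.mem_map.1 hy
        simpa [nbrs_map] using h2 x z hz
      · simp [nbrs_map_of_notMem_range f M hx] at hy

/-- The permanental sum is unchanged by relabelling and adding isolated vertices. -/
lemma PS_map (f : V ↪ W) (G : SimpleGraph V) : PS (G.map f) = PS G := by
  symm
  refine Finset.sum_bij (fun M _ => M.map f.sym2Map) ?_ ?_ ?_ ?_
  · intro M hM
    simp only [Finset.mem_filter_univ, isSachs_iff, edgeSet_map, sachsDegrees_map] at hM ⊢
    refine ⟨?_, hM.2⟩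
    rw [Finset.coe_map]
    exact Set.image_mono hM.1
  · intro M _ N _ h
    exact Finset.map_injective _ h
  · intro N hN
    simp only [Finset.mem_filter_univ, isSachs_iff, edgeSet_map] at hN ⊢
    obtain ⟨M, hM, rfl⟩ := Finset.subset_set_image_iff.1 hN.1
    have : M.image f.sym2Map = M.map f.sym2Map := (Finset.map_eq_image _ _).symm
    rw [this, sachsDegrees_map] at hN
    exact ⟨M, ⟨hM, hN.2⟩, this.symm⟩
  · intro M hM
    rw [Finset.mem_filter_univ, isSachs_iff] at hM
    congr 1
    refine numCycles_eq_of_equiv hM.2 ((sachsDegrees_map f).2 hM.2) f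
      (fun x _ => nbrs_map f M x) fun y hy => ?_
    by_cases hy' : y ∈ Set.range f
    · obtain ⟨x, rfl⟩ := hy'
      exact ⟨x, by simpa [nbrs_map] using hy, rfl⟩
    · simp [nbrs_map_of_notMem_range f M hy'] at hy

lemma mem_nbrs_insert {M : Finset (Sym2 V)} {u v x y : V} (huv : u ≠ v) :
    y ∈ nbrs (insert s(u, v) M) x ↔ (x = u ∧ y = v) ∨ (x = v ∧ y = u) ∨ y ∈ nbrs M x := by
  simp only [mem_nbrs, Finset.mem_insert, Sym2.eq_iff]
  grind

/-- Adding a disjoint edge to the edge set of a graph. -/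
lemma nbrs_insert_of_disjoint {M : Finset (Sym2 V)} {u v : V} (huv : u ≠ v)
    (hu : nbrs M u = ∅) (hv : nbrs M v = ∅) (x : V) :
    nbrs (insert s(u, v) M) x = if x = u then {v} else if x = v then {u} else nbrs M x := by
  ext y
  rw [mem_nbrs_insert huv]
  split_ifs with h1 h2
  · subst h1; simp [hu, huv]
  · subst h2; simp [hv, h1]
  · simp [h1, h2]

lemma sachsDegrees_insert_of_disjoint {M : Finset (Sym2 V)} {u v : V} (huv : u ≠ v)
    (hu : nbrs M u = ∅) (hv : nbrs M v = ∅) :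
    SachsDegrees (insert s(u, v) M) ↔ SachsDegrees M := by
  have hne : ∀ x, ∀ y ∈ nbrs M x, x ≠ u ∧ x ≠ v ∧ y ≠ u ∧ y ≠ v := by
    intro x y hy
    have hx := mem_nbrs_comm.1 hy
    refine ⟨?_, ?_, ?_, ?_⟩ <;> rintro rfl <;> simp_all
  have hN := nbrs_insert_of_disjoint huv hu hv
  constructor
  · rintro ⟨h1, h2⟩
    constructor
    · intro x
      have := h1 x
      rw [hN] at this
      split_ifs at this <;> simp_all
    · intro x y hy
      obtain ⟨a, b, c, d⟩ := hne x y hy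
      have := h2 x y
      simp only [hN, a, b, c, d, if_false] at this
      exact this hy
  · rintro ⟨h1, h2⟩
    constructor
    · intro x
      rw [hN]
      split_ifs <;> simp [h1]
    · intro x y hy
      rw [hN] at hy
      rw [hN, hN]
      split_ifs at hy with a b
      · simp_all
      · simp_all
      · obtain ⟨-, -, c, d⟩ := hne x y hy
        simpa [a, b, c, d] using h2 x y hy

lemma numCycles_insert_of_disjoint {M : Finset (Sym2 V)} {u v : V} (huv : u ≠ v)
    (hu : nbrs M u = ∅) (hv : nbrs M v = ∅) (hM : SachsDegrees M) :
    numCycles (insert s(u, v) M) = numCycles M := by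
  have hN := nbrs_insert_of_disjoint huv hu hv
  refine (numCycles_eq_of_equiv hM ((sachsDegrees_insert_of_disjoint huv hu hv).2 hM)
    (Function.Embedding.refl V) (fun x hx => ?_) fun y hy => ?_).symm
  · have h1 : x ≠ u := by rintro rfl; simp [hu] at hx
    have h2 : x ≠ v := by rintro rfl; simp [hv] at hx
    simp [hN, h1, h2]
  · rw [hN] at hy
    split_ifs at hy
    · simp at hy
    · simp at hy
    · exact ⟨y, hy, rfl⟩

/-- The pendant edge recurrence: `G'` is `G` without the pendant edge `uv`, and `G''` is `G`
without the edges at `u`. -/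
lemma PS_pendant {G G' G'' : SimpleGraph V} {u v : V} (hv : ∀ x, G.Adj v x ↔ x = u)
    (h' : ∀ x y, G'.Adj x y ↔ G.Adj x y ∧ s(x, y) ≠ s(u, v))
    (h'' : ∀ x y, G''.Adj x y ↔ G.Adj x y ∧ x ≠ u ∧ y ≠ u) :
    PS G = PS G' + PS G'' := by
  have huv : u ≠ v := (((hv u).2 rfl).ne).symm
  have hE' : ∀ e, e ∈ G'.edgeSet ↔ e ∈ G.edgeSet ∧ e ≠ s(u, v) :=
    fun e => Sym2.ind (fun x y => h' x y) e
  have hE'' : ∀ e, e ∈ G''.edgeSet ↔ e ∈ G.edgeSet ∧ u ∉ e :=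
    fun e => Sym2.ind (fun x y => by simp [h'', eq_comm]) e
  have hiso : ∀ {M : Finset (Sym2 V)}, (↑M : Set (Sym2 V)) ⊆ G''.edgeSet →
      nbrs M u = ∅ ∧ nbrs M v = ∅ := by
    intro M hM
    constructor <;> refine Finset.eq_empty_of_forall_notMem fun z hz => ?_
    · have := hM (mem_nbrs.1 hz).1
      rw [mem_edgeSet, h''] at this
      exact this.2.1 rfl
    · have := hM (mem_nbrs.1 hz).1
      rw [mem_edgeSet, h'', hv] at this
      exact this.2.2 this.1
  unfold PS
  rw [← Finset.sum_filter_not_add_sum_filter _ (fun M => s(u, v) ∈ M)]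
  congr 1
  · refine Finset.sum_congr ?_ fun _ _ => rfl
    ext M
    simp only [Finset.mem_filter, Finset.mem_univ, true_and, isSachs_iff, Set.subset_def, hE',
      Finset.mem_coe]
    grind
  · symm
    refine Finset.sum_bij (fun M _ => insert s(u, v) M) ?_ ?_ ?_ ?_
    · intro M hM
      simp only [Finset.mem_filter, Finset.mem_univ, true_and, isSachs_iff] at hM ⊢
      obtain ⟨h1, h2⟩ := hiso hM.1
      refine ⟨⟨?_, (sachsDegrees_insert_of_disjoint huv h1 h2).2 hM.2⟩, by simp⟩
      rw [Finset.coe_insert, Set.insert_subset_iff]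
      exact ⟨((hv u).2 rfl).symm, fun e he => ((hE'' e).1 (hM.1 he)).1⟩
    · intro M hM N hN h
      simp only [Finset.mem_filter, Finset.mem_univ, true_and, isSachs_iff] at hM hN
      have key : ∀ {M : Finset (Sym2 V)}, (↑M : Set (Sym2 V)) ⊆ G''.edgeSet → s(u, v) ∉ M :=
        fun hM he => ((hE'' _).1 (hM he)).2 (by simp)
      rw [← Finset.erase_insert (key hM.1), h, Finset.erase_insert (key hN.1)]
    · intro N hN
      simp only [Finset.mem_filter, Finset.mem_univ, true_and, isSachs_iff] at hN ⊢
      obtain ⟨⟨hG, hS⟩, he⟩ := hN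
      have hNv : nbrs N v = {u} := by
        ext z
        rw [Finset.mem_singleton]
        constructor
        · intro hz
          exact (hv z).1 (hG (mem_nbrs.1 hz).1)
        · rintro rfl
          exact mem_nbrs_comm.1 (mem_nbrs.2 ⟨he, huv⟩)
      have hNu : nbrs N u = {v} := by
        have h1 : v ∈ nbrs N u := mem_nbrs.2 ⟨he, huv⟩
        have h2 := hS.2 v u (by simp [hNv]) (by simp [hNv])
        obtain ⟨w, hw⟩ := Finset.card_eq_one.1 h2
        rw [hw, Finset.mem_singleton] at h1
        rw [hw, h1]
      have hsub : (↑(N.erase s(u, v)) : Set (Sym2 V)) ⊆ G''.edgeSet := by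
        intro e hmem
        rw [Finset.mem_coe, Finset.mem_erase] at hmem
        refine (hE'' e).2 ⟨hG hmem.2, fun hu => ?_⟩
        obtain ⟨w, rfl⟩ := hu
        have hw : w ∈ nbrs N u := mem_nbrs.2 ⟨hmem.2, (hG hmem.2 : G.Adj u w).ne⟩
        rw [hNu, Finset.mem_singleton] at hw
        exact hmem.1 (by rw [hw])
      obtain ⟨h1, h2⟩ := hiso hsub
      refine ⟨N.erase s(u, v), ⟨hsub, ?_⟩, Finset.insert_erase he⟩
      rw [← sachsDegrees_insert_of_disjoint huv h1 h2, Finset.insert_erase he]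
      exact hS
    · intro M hM
      rw [Finset.mem_filter_univ, isSachs_iff] at hM
      obtain ⟨h1, h2⟩ := hiso hM.1
      rw [numCycles_insert_of_disjoint huv h1 h2 hM.2]

/-- If the vertices of degree two are at distance at most two from each other, then there is at
most one cycle. -/
lemma SachsDegrees.numCycles_eq_ite {M : Finset (Sym2 V)} (h : SachsDegrees M)
    (hd : ∀ x y, #(nbrs M x) = 2 → #(nbrs M y) = 2 →
      x = y ∨ y ∈ nbrs M x ∨ ∃ z ∈ nbrs M x, y ∈ nbrs M z) :
    numCycles M = if ∃ x, #(nbrs M x) = 2 then 1 else 0 := by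
  rw [h.numCycles_eq]
  split_ifs with hx
  · obtain ⟨x, hx⟩ := hx
    have : Subsingleton (cycleGraphPart M).ConnectedComponent := by
      refine Preconnected.subsingleton_connectedComponent fun a b => ?_
      rcases hd a.1 b.1 a.2 b.2 with hab | hab | ⟨z, hz, hab⟩
      · rw [Subtype.ext hab]
      · exact (cycleGraphPart_adj.2 hab).reachable
      · have hz' : (cycleGraphPart M).Adj a ⟨z, h.card_nbrs_eq_two a.2 hz⟩ :=
          cycleGraphPart_adj.2 hz
        exact hz'.reachable.trans (Adj.reachable (cycleGraphPart_adj.2 hab))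
    have : Nonempty (cycleGraphPart M).ConnectedComponent :=
      ⟨(cycleGraphPart M).connectedComponentMk ⟨x, hx⟩⟩
    exact Nat.card_eq_one_iff_unique.2 ⟨‹_›, ‹_›⟩
  · have : IsEmpty (cycleGraphPart M).ConnectedComponent :=
      ⟨fun c => ConnectedComponent.ind (fun a => hx ⟨a.1, a.2⟩) c⟩
    exact Nat.card_of_isEmpty

lemma PS_eq_sum_powerset {G : SimpleGraph V} {E : Finset (Sym2 V)}
    (hE : G.edgeSet = ↑E)
    (hd : ∀ M ∈ E.powerset, SachsDegrees M → ∀ x y, #(nbrs M x) = 2 → #(nbrs M y) = 2 →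
      x = y ∨ y ∈ nbrs M x ∨ ∃ z ∈ nbrs M x, y ∈ nbrs M z) :
    PS G = ∑ M ∈ E.powerset.filter SachsDegrees,
      2 ^ (if ∃ x, #(nbrs M x) = 2 then 1 else 0) := by
  refine Finset.sum_congr ?_ fun M hM => ?_
  · ext M
    simp [isSachs_iff, hE]
  · rw [Finset.mem_filter] at hM
    rw [hM.2.numCycles_eq_ite (hd M hM.1 hM.2)]

end Sachs

/-- The subgraph of `B₃'(1,1,0)` induced by the first `k` vertices, as a graph on `Fin n`. -/
def B3trunc (n k : ℕ) : SimpleGraph (Fin n) where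
  Adj i j := i.val < k ∧ j.val < k ∧ (i.val + 1 = j.val ∨ j.val + 1 = i.val ∨
    (i.val = 0 ∧ j.val = 2) ∨ (i.val = 2 ∧ j.val = 0) ∨
    (i.val = 1 ∧ j.val = 3) ∨ (i.val = 3 ∧ j.val = 1))
  symm := ⟨fun i j h => by omega⟩
  loopless := ⟨fun i h => by omega⟩

instance (n k : ℕ) : DecidableRel (B3trunc n k).Adj := fun i j => by
  unfold B3trunc; infer_instance

lemma B3deg2_eq (m : ℕ) : B3deg2 m = B3trunc (m + 4) (m + 4) := by
  have h0 : (0 : Fin (m + 4)) = ⟨0, by omega⟩ := rfl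
  have h1 : (1 : Fin (m + 4)) = ⟨1, by omega⟩ := Fin.ext (Nat.mod_eq_of_lt (show 1 < m + 4 by omega))
  have h2 : (2 : Fin (m + 4)) = ⟨2, by omega⟩ := Fin.ext (Nat.mod_eq_of_lt (show 2 < m + 4 by omega))
  have h3 : (3 : Fin (m + 4)) = ⟨3, by omega⟩ := Fin.ext (Nat.mod_eq_of_lt (show 3 < m + 4 by omega))
  ext i j
  simp only [B3deg2, B3trunc, sup_adj, pathGraph_adj, fromEdgeSet_adj, Set.mem_insert_iff,
    Set.mem_singleton_iff, Sym2.eq_iff, h0, h1, h2, h3, Fin.ext_iff, ne_eq]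
  omega

lemma B3trunc_eq_map {n k : ℕ} (hn : 4 ≤ n) (hk : k ≤ 4) :
    B3trunc n k = (B3trunc 4 k).map (Fin.castLEEmb hn) := by
  ext i j
  simp only [map_adj, Fin.castLEEmb_apply]
  constructor
  · intro h
    have hi : i.val < k := h.1
    have hj : j.val < k := h.2.1
    exact ⟨⟨i, by omega⟩, ⟨j, by omega⟩, h, rfl, rfl⟩
  · rintro ⟨a, b, h, rfl, rfl⟩
    exact h

lemma PS_B3trunc_four_three : PS (B3trunc 4 3) = 6 := by
  rw [PS_eq_sum_powerset (E := {s(0, 1), s(1, 2), s(0, 2)})]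
  · decide +kernel
  · ext e
    rw [Finset.mem_coe]
    revert e
    decide +kernel
  · decide +kernel

lemma PS_B3trunc_four_four : PS (B3trunc 4 4) = 14 := by
  rw [PS_eq_sum_powerset (E := {s(0, 1), s(1, 2), s(2, 3), s(0, 2), s(1, 3)})]
  · decide +kernel
  · ext e
    rw [Finset.mem_coe]
    revert e
    decide +kernel
  · decide +kernel

lemma PS_B3trunc_add_two {n k : ℕ} (hk : 3 ≤ k) (hn : k + 2 ≤ n) :
    PS (B3trunc n (k + 2)) = PS (B3trunc n (k + 1)) + PS (B3trunc n k) := by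
  refine PS_pendant (u := ⟨k, by omega⟩) (v := ⟨k + 1, by omega⟩) ?_ ?_ ?_
  · intro x
    simp only [B3trunc, Fin.ext_iff]
    omega
  · intro x y
    simp only [B3trunc, Fin.ext_iff, ne_eq, Sym2.eq_iff]
    omega
  · intro x y
    simp only [B3trunc, Fin.ext_iff, ne_eq]
    omega

lemma PS_B3trunc {n : ℕ} (m : ℕ) (hn : m + 4 ≤ n) :
    PS (B3trunc n (m + 4)) = 14 * Nat.fib (m + 1) + 6 * Nat.fib m := by
  induction m using Nat.twoStepInduction with
  | zero =>
    rw [B3trunc_eq_map (by omega) le_rfl, PS_map, PS_B3trunc_four_four]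
    rfl
  | one =>
    rw [PS_B3trunc_add_two (k := 3) le_rfl hn, B3trunc_eq_map (k := 4) (by omega) le_rfl,
      B3trunc_eq_map (k := 3) (by omega) (by omega), PS_map, PS_map, PS_B3trunc_four_four,
      PS_B3trunc_four_three]
    rfl
  | more m ih0 ih1 =>
    rw [PS_B3trunc_add_two (k := m + 4) (by omega) hn, ih0 (by omega)]
    have := ih1 (by omega)
    rw [show m + 4 + 1 = m + 1 + 4 by omega, this, Nat.fib_add_two (n := m + 1),
      Nat.fib_add_two (n := m)]
    ring

/-- `PS(B₃(1,1,0)) = 14` and `PS(B₃'(1,1,0,n-4)) = 14·F(n-3) + 6·F(n-4)` for `n ≥ 5`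
(here `n = m + 4`, `m ≥ 1`; `B3deg2 0` is `K₄` minus an edge). -/
theorem PS_B3 :
    PS (B3deg2 0) = 14 ∧
    ∀ m : ℕ, 1 ≤ m → PS (B3deg2 m) = 14 * Nat.fib (m + 1) + 6 * Nat.fib m := by
  refine ⟨?_, fun m _ => ?_⟩
  · rw [B3deg2_eq, PS_B3trunc 0 le_rfl]
    rfl
  · rw [B3deg2_eq, PS_B3trunc m le_rfl]

end PermSum
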